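/- Fix a strictly increasing sequence of positive integers (M_k)_{k≥0} with M_0 = 1 and M_{k+1}/M_k → ∞. Let π : {0,1}^{ℕ≥1} → [0,1] be π(x) = Σ_{j≥1} x_j 2^{−j}. Let A = π(Ã), where Ã is the set of sequences x ∈ {0,1}^{ℕ≥1} such that for every even k ≥ 0 the sequence (x_j) is constant for j ∈ [M_k, M_{k+1}) ∩ ℕ, and let B = π(B̃), where B̃ is defined analogously with odd k. Set X = ({0} × ⋃_{n∈ℤ}(A+n)) ∪ ({1} × ⋃_{n∈ℤ}(B+n)) ⊆ ℝ². Then the Hausdorff dimension of X equals 0 (in particular dim_H A = dim_H B = 0). -/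

import Mathlib

open Set Filter

/-- The binary coding map `π(x) = ∑_{j≥1} x_j 2^{−j}` (sequences indexed so that the
`j`-th binary digit is `x j` for `j ≥ 1`). -/
noncomputable def binCode (x : ℕ → ℕ) : ℝ := ∑' j : ℕ, (x (j + 1) : ℝ) / 2 ^ (j + 1)

/-- The set of `{0,1}`-sequences that are constant on every block `[M_k, M_{k+1}) ∩ ℕ`
with `k % 2 = par`. -/
def blockConstant (M : ℕ → ℕ) (par : ℕ) : Set (ℕ → ℕ) :=
  {x | (∀ j, x j ≤ 1) ∧ ∀ k : ℕ, k % 2 = par →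
    ∀ i j : ℕ, M k ≤ i → i < M (k + 1) → M k ≤ j → j < M (k + 1) → x i = x j}

/-- `A = π(Ã)`: blocks with even `k` are constant. -/
def KanA (M : ℕ → ℕ) : Set ℝ := binCode '' blockConstant M 0

/-- `B = π(B̃)`: blocks with odd `k` are constant. -/
def KanB (M : ℕ → ℕ) : Set ℝ := binCode '' blockConstant M 1

/-- The modified Kan set `X = ({0} × ⋃_{n∈ℤ}(A+n)) ∪ ({1} × ⋃_{n∈ℤ}(B+n)) ⊆ ℝ²`. -/
def KanX (M : ℕ → ℕ) : Set (ℝ × ℝ) :=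
  ({(0 : ℝ)} ×ˢ ⋃ n : ℤ, (fun a => a + (n : ℝ)) '' KanA M) ∪
  ({(1 : ℝ)} ×ˢ ⋃ n : ℤ, (fun a => a + (n : ℝ)) '' KanB M)

lemma kan_summable (x : ℕ → ℕ) (hx : ∀ j, x j ≤ 1) :
    Summable (fun j : ℕ => (x (j + 1) : ℝ) / 2 ^ (j + 1)) := by
  refine Summable.of_nonneg_of_le (fun j => by positivity) (fun j => ?_)
    (summable_geometric_two' 1)
  have h : (x (j + 1) : ℝ) ≤ 1 := by exact_mod_cast hx _
  rw [pow_succ', ← div_div]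
  gcongr

lemma kan_dist (x y : ℕ → ℕ) (hx : ∀ j, x j ≤ 1) (hy : ∀ j, y j ≤ 1) (m : ℕ)
    (h : ∀ j < m + 1, x j = y j) : dist (binCode x) (binCode y) ≤ 1 / 2 ^ m := by
  have sx := kan_summable x hx
  have sy := kan_summable y hy
  rw [Real.dist_eq, binCode, binCode, ← sx.tsum_sub sy, ← (sx.sub sy).sum_add_tsum_nat_add m]
  rw [Finset.sum_eq_zero, zero_add, ← Real.norm_eq_abs]
  · refine tsum_of_norm_bounded (hasSum_geometric_two' (1 / 2 ^ m)) (fun i => ?_)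
    rw [← sub_div, Real.norm_eq_abs, abs_div]
    have h1 : (x (i + m + 1) : ℝ) ≤ 1 := by exact_mod_cast hx _
    have h2 : (y (i + m + 1) : ℝ) ≤ 1 := by exact_mod_cast hy _
    have h3 : |(x (i + m + 1) : ℝ) - y (i + m + 1)| ≤ 1 := by
      rw [abs_le]
      constructor <;> linarith [Nat.cast_nonneg (α := ℝ) (x (i + m + 1)),
        Nat.cast_nonneg (α := ℝ) (y (i + m + 1))]
    have e : (1 : ℝ) / 2 ^ m / 2 / 2 ^ i = 1 / |2 ^ (i + m + 1)| := by
      rw [abs_of_pos (by positivity)]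
      field_simp
      ring
    rw [e]
    gcongr
  · intro i hi
    rw [h (i + 1) (by simpa using hi)]
    simp

open MeasureTheory in
open scoped ENNReal NNReal in
lemma kan_dim (M : ℕ → ℕ) (hM : StrictMono M) (hM0 : M 0 = 1)
    (hMratio : Filter.Tendsto (fun k => (M (k + 1) : ℝ) / (M k : ℝ)) Filter.atTop Filter.atTop)
    (par : ℕ) (hpar : par < 2) : dimH (binCode '' blockConstant M par) = 0 := by
  have hpos : ∀ k, 1 ≤ M k := fun k => hM0 ▸ hM.monotone (Nat.zero_le k)
  have key : ∀ d : ℝ≥0, 0 < d → dimH (binCode '' blockConstant M par) ≤ d := by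
    intro d hd
    have hd' : (0 : ℝ) < d := hd
    apply dimH_le_of_hausdorffMeasure_ne_top
    let K : ℕ → ℕ := fun n => 2 * n + par
    have hK : Tendsto K atTop atTop :=
      tendsto_atTop_mono (fun n => (by simp only [K]; omega : n ≤ K n)) tendsto_id
    let t : (n : ℕ) → ((Fin (M (K n)) → Fin 2) × Fin 2) → Set ℝ := fun n w =>
      binCode '' {x | x ∈ blockConstant M par ∧ (∀ j : Fin (M (K n)), x j = (w.1 j : ℕ)) ∧
        x (M (K n)) = (w.2 : ℕ)}
    have hdiam : ∀ n i, Metric.ediam (t n i) ≤ ENNReal.ofReal (1 / 2 ^ (M (K n + 1) - 1)) := by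
      intro n w
      apply Metric.ediam_le
      rintro _ ⟨x, ⟨hx, hx1, hx2⟩, rfl⟩ _ ⟨y, ⟨hy, hy1, hy2⟩, rfl⟩
      rw [edist_dist]
      apply ENNReal.ofReal_le_ofReal
      apply kan_dist x y hx.1 hy.1
      intro j hj
      have := hpos (K n + 1)
      rcases lt_or_ge j (M (K n)) with h | h
      · exact (hx1 ⟨j, h⟩).trans (hy1 ⟨j, h⟩).symm
      · have hk : K n % 2 = par := by simp only [K]; omega
        have hl : M (K n) < M (K n + 1) := hM (Nat.lt_succ_self _)
        rw [hx.2 _ hk j (M (K n)) h (by omega) le_rfl hl,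
          hy.2 _ hk j (M (K n)) h (by omega) le_rfl hl, hx2, hy2]
    have hM1 : Tendsto (fun n => M (K n + 1) - 1) atTop atTop :=
      (tendsto_sub_atTop_nat 1).comp (hM.tendsto_atTop.comp ((tendsto_add_atTop_nat 1).comp hK))
    have hr : Tendsto (fun n => ENNReal.ofReal (1 / 2 ^ (M (K n + 1) - 1))) atTop (nhds 0) := by
      rw [← ENNReal.ofReal_zero]
      apply ENNReal.tendsto_ofReal
      have := (tendsto_pow_atTop_nhds_zero_of_lt_one (r := (1/2 : ℝ)) (by norm_num)
        (by norm_num)).comp hM1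
      refine this.congr fun n => ?_
      simp
    have hcov : ∀ n, binCode '' blockConstant M par ⊆ ⋃ i, t n i := by
      rintro n _ ⟨x, hx, rfl⟩
      rw [mem_iUnion]
      refine ⟨(fun j => ⟨x j, Nat.lt_succ_of_le (hx.1 _)⟩,
        ⟨x (M (K n)), Nat.lt_succ_of_le (hx.1 _)⟩), x, ⟨hx, fun j => rfl, rfl⟩, rfl⟩
    have := Measure.hausdorffMeasure_le_liminf_sum (d : ℝ) (binCode '' blockConstant M par)
      (l := atTop) _ hr t (Eventually.of_forall hdiam) (Eventually.of_forall hcov)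
    refine ne_top_of_le_ne_top ENNReal.one_ne_top (this.trans ?_)
    refine liminf_le_of_frequently_le' (Eventually.frequently ?_)
    filter_upwards [(hMratio.comp hK).eventually_ge_atTop (2 / d + 1)] with n hn
    simp only [Function.comp] at hn
    have hp : (1 : ℝ) ≤ M (K n) := by exact_mod_cast hpos _
    rw [le_div_iff₀ (by linarith)] at hn
    have h1 : (M (K n) : ℝ) + 1 ≤ d * ((M (K n + 1) - 1 : ℕ) : ℝ) := by
      rw [Nat.cast_sub (hpos _), Nat.cast_one]
      have h2 := mul_le_mul_of_nonneg_left hn hd'.le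
      have h3 : (d : ℝ) * ((2 / d + 1) * M (K n)) = 2 * M (K n) + d * M (K n) := by
        field_simp
      nlinarith
    calc ∑ i, Metric.ediam (t n i) ^ (d : ℝ)
        ≤ ∑ i : (Fin (M (K n)) → Fin 2) × Fin 2,
            ENNReal.ofReal (1 / 2 ^ (M (K n) + 1)) := by
          refine Finset.sum_le_sum fun i _ => ?_
          refine (ENNReal.rpow_le_rpow (hdiam n i) hd'.le).trans ?_
          rw [ENNReal.ofReal_rpow_of_pos (by positivity)]
          apply ENNReal.ofReal_le_ofReal
          rw [one_div, one_div, ← Real.rpow_natCast, ← Real.rpow_natCast,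
            ← Real.rpow_neg (by norm_num), ← Real.rpow_neg (by norm_num),
            ← Real.rpow_mul (by norm_num)]
          apply Real.rpow_le_rpow_of_exponent_le (by norm_num)
          push_cast
          linarith
      _ = 1 := by
          rw [Finset.sum_const, nsmul_eq_mul, Finset.card_univ, Fintype.card_prod,
            Fintype.card_fun, Fintype.card_fin, Fintype.card_fin, ← pow_succ,
            ← ENNReal.ofReal_natCast, ← ENNReal.ofReal_mul (by positivity)]
          simp
      _ ≤ 1 := le_rfl
  refine le_antisymm ?_ (zero_le)
  refine ENNReal.le_of_forall_pos_le_add fun ε hε _ => ?_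
  simpa using key ε hε

lemma kan_slice (c : ℝ) (s : Set ℝ) (hs : dimH s = 0) :
    dimH ({c} ×ˢ ⋃ n : ℤ, (fun a => a + (n : ℝ)) '' s) = 0 := by
  have h : Isometry (fun a : ℝ => (c, a)) := by
    intro a b
    simp [Prod.edist_eq]
  rw [singleton_prod, h.dimH_image, dimH_iUnion]
  simp only [ENNReal.iSup_eq_zero]
  intro n
  rw [(isometry_add_right (n : ℝ)).dimH_image, hs]

theorem kan_hausdorff_dimension_zero (M : ℕ → ℕ) (hM : StrictMono M) (hM0 : M 0 = 1)
    (hMratio : Filter.Tendsto (fun k => (M (k + 1) : ℝ) / (M k : ℝ)) Filter.atTop Filter.atTop) :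
    dimH (KanX M) = 0 ∧ dimH (KanA M) = 0 ∧ dimH (KanB M) = 0 := by
  have hA : dimH (KanA M) = 0 := kan_dim M hM hM0 hMratio 0 (by norm_num)
  have hB : dimH (KanB M) = 0 := kan_dim M hM hM0 hMratio 1 (by norm_num)
  refine ⟨?_, hA, hB⟩
  rw [KanX, dimH_union, kan_slice _ _ hA, kan_slice _ _ hB, max_self]
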